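/- For every feasible symmetric capacitated cost-sharing game on a series of k parallel-edge blocks with n agents, every strong equilibrium σ, and every feasible profile τ, the social cost of σ is at most H_n times the social cost of τ, where H_n = 1 + 1/2 + … + 1/n. -/

import Mathlib

/-- The load of edge `e` of block `j` under profile `σ`. -/
def blockLoad {n k : ℕ} {E : Fin k → Type*} [∀ j, Fintype (E j)] [∀ j, DecidableEq (E j)]
    (σ : Fin n → ∀ j, E j) (j : Fin k) (e : E j) : ℕ :=
  (Finset.univ.filter fun i => σ i j = e).card

/-- A profile is feasible if no edge load exceeds its capacity. -/
def FeasibleB {n k : ℕ} {E : Fin k → Type*} [∀ j, Fintype (E j)] [∀ j, DecidableEq (E j)]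
    (c : ∀ j, E j → ℕ) (σ : Fin n → ∀ j, E j) : Prop :=
  ∀ j e, blockLoad σ j e ≤ c j e

/-- The cost of agent `i`: in each block, the cost of her chosen edge divided equally
among its users, summed over all blocks. -/
noncomputable def agentCostB {n k : ℕ} {E : Fin k → Type*}
    [∀ j, Fintype (E j)] [∀ j, DecidableEq (E j)]
    (p : ∀ j, E j → ℝ) (σ : Fin n → ∀ j, E j) (i : Fin n) : ℝ :=
  ∑ j, p j (σ i j) / (blockLoad σ j (σ i j) : ℝ)

/-- The social cost of a profile: the sum of all agents' costs. -/
noncomputable def socialCostB {n k : ℕ} {E : Fin k → Type*}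
    [∀ j, Fintype (E j)] [∀ j, DecidableEq (E j)]
    (p : ∀ j, E j → ℝ) (σ : Fin n → ∀ j, E j) : ℝ :=
  ∑ i, agentCostB p σ i

/-- A feasible profile is a strong equilibrium if no nonempty coalition has a feasible
deviation that strictly decreases the cost of each of its members. -/
def IsStrongEqB {n k : ℕ} {E : Fin k → Type*} [∀ j, Fintype (E j)] [∀ j, DecidableEq (E j)]
    (p : ∀ j, E j → ℝ) (c : ∀ j, E j → ℕ) (σ : Fin n → ∀ j, E j) : Prop :=
  FeasibleB c σ ∧
    ¬ ∃ (C : Finset (Fin n)) (σ' : Fin n → ∀ j, E j),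
        C.Nonempty ∧ FeasibleB c σ' ∧ (∀ i ∉ C, σ' i = σ i) ∧
        ∀ i ∈ C, agentCostB p σ' i < agentCostB p σ i

/-- The `m`-th harmonic number `1 + 1/2 + ⋯ + 1/m` (with value `0` at `m = 0`). -/
noncomputable def harmonicReal (m : ℕ) : ℝ :=
  ∑ i ∈ Finset.range m, (1 : ℝ) / (i + 1)

/-- Any two maps on a finite type can be aligned by permuting the second one: on each fibre, one
of the two maps then dominates the other. -/
theorem exists_perm_fibers_nested {ι α : Type*} [Fintype ι] [DecidableEq ι] [DecidableEq α]
    (f g : ι → α) :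
    ∃ π : Equiv.Perm ι, ∀ a, (∀ i, f i = a → g (π i) = a) ∨ (∀ i, g (π i) = a → f i = a) := by
  obtain ⟨π, hπ⟩ := Finite.exists_max
    fun π : Equiv.Perm ι => (Finset.univ.filter fun i => g (π i) = f i).card
  refine ⟨π, fun a => ?_⟩
  by_contra! h
  obtain ⟨⟨i, hi, hi'⟩, l, hl, hl'⟩ := h
  refine (hπ (π * Equiv.swap i l)).not_gt
    (Finset.card_lt_card ((Finset.ssubset_iff_of_subset fun m hm => ?_).2 ⟨i, ?_, ?_⟩))
  · rw [Finset.mem_filter_univ] at hm ⊢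
    have hmi : m ≠ i := by
      rintro rfl
      exact hi' (hm.trans hi)
    have hml : m ≠ l := by
      rintro rfl
      exact hl' (hm.symm.trans hl)
    rwa [Equiv.Perm.mul_apply, Equiv.swap_apply_of_ne_of_ne hmi hml]
  · rw [Finset.mem_filter_univ, Equiv.Perm.mul_apply, Equiv.swap_apply_left, hl, hi]
  · simpa [hi] using hi'

theorem harmonicReal_mono : Monotone harmonicReal := fun a b hab =>
  Finset.sum_le_sum_of_subset_of_nonneg (Finset.range_mono hab) fun i _ _ => by positivity

theorem harmonicReal_succ (m : ℕ) : harmonicReal (m + 1) = harmonicReal m + 1 / (m + 1) :=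
  Finset.sum_range_succ _ _

section

variable {n k : ℕ} {E : Fin k → Type*} [∀ j, Fintype (E j)] [∀ j, DecidableEq (E j)]

/-- The social cost is the total cost of the edges in use. -/
theorem socialCostB_eq_sum_used (p : ∀ j, E j → ℝ) (σ : Fin n → ∀ j, E j) :
    socialCostB p σ = ∑ j, ∑ e, if blockLoad σ j e = 0 then 0 else p j e := by
  unfold socialCostB agentCostB
  rw [Finset.sum_comm]
  refine Finset.sum_congr rfl fun j _ => ?_
  rw [← Finset.sum_fiberwise Finset.univ (fun i => σ i j)]
  refine Finset.sum_congr rfl fun e _ => ?_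
  have h : ∀ i ∈ Finset.univ.filter (fun i => σ i j = e),
      p j (σ i j) / (blockLoad σ j (σ i j) : ℝ) = p j e / (blockLoad σ j e : ℝ) := by
    intro i hi
    rw [(Finset.mem_filter.1 hi).2]
  rw [Finset.sum_congr rfl h, Finset.sum_const, nsmul_eq_mul]
  change (blockLoad σ j e : ℝ) * _ = _
  split_ifs with h0
  · simp [h0]
  · field_simp

/-- If the fibres of `τ` and `σ` are nested in every block, then every profile mixing the two
is feasible. -/
theorem FeasibleB.ite_mem {c : ∀ j, E j → ℕ} {σ τ : Fin n → ∀ j, E j}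
    (hσ : FeasibleB c σ) (hτ : FeasibleB c τ)
    (h : ∀ j e, (∀ i, σ i j = e → τ i j = e) ∨ (∀ i, τ i j = e → σ i j = e))
    (C : Finset (Fin n)) : FeasibleB c fun i => if i ∈ C then τ i else σ i := by
  intro j e
  rcases h j e with h | h
  · refine (Finset.card_le_card fun i hi => ?_).trans (hτ j e)
    simp only [Finset.mem_filter, Finset.mem_univ, true_and] at hi ⊢
    split_ifs at hi
    · exact hi
    · exact h i hi
  · refine (Finset.card_le_card fun i hi => ?_).trans (hσ j e)
    simp only [Finset.mem_filter, Finset.mem_univ, true_and] at hi ⊢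
    split_ifs at hi
    · exact h i hi
    · exact hi

/-- The Rosenthal potential of `τ` restricted to the agents in `C`. -/
noncomputable def coalitionPotential (p : ∀ j, E j → ℝ) (τ : Fin n → ∀ j, E j)
    (C : Finset (Fin n)) : ℝ :=
  ∑ j, ∑ e, p j e * harmonicReal (C.filter fun i => τ i j = e).card

theorem coalitionPotential_eq_erase_add (p : ∀ j, E j → ℝ) (τ : Fin n → ∀ j, E j)
    {C : Finset (Fin n)} {i : Fin n} (hi : i ∈ C) :
    coalitionPotential p τ C = coalitionPotential p τ (C.erase i) +
      ∑ j, p j (τ i j) / ((C.filter fun l => τ l j = τ i j).card : ℝ) := by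
  unfold coalitionPotential
  rw [← Finset.sum_add_distrib]
  refine Finset.sum_congr rfl fun j _ => ?_
  rw [← Finset.add_sum_erase _ _ (Finset.mem_univ (τ i j)),
    ← Finset.add_sum_erase _ (fun e => p j e * harmonicReal _) (Finset.mem_univ (τ i j))]
  have hother : ∀ e ∈ Finset.univ.erase (τ i j),
      p j e * harmonicReal (C.filter fun l => τ l j = e).card =
        p j e * harmonicReal ((C.erase i).filter fun l => τ l j = e).card := by
    intro e he
    rw [Finset.filter_erase, Finset.erase_eq_of_notMem]
    intro h
    exact Finset.ne_of_mem_erase he (Finset.mem_filter.1 h).2.symm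
  have hcard : (C.filter fun l => τ l j = τ i j).card =
      ((C.erase i).filter fun l => τ l j = τ i j).card + 1 := by
    rw [Finset.filter_erase, Finset.card_erase_add_one]
    exact Finset.mem_filter.2 ⟨hi, rfl⟩
  rw [Finset.sum_congr rfl hother, hcard, harmonicReal_succ]
  push_cast
  ring

/-- In a strong equilibrium, the cost of a coalition is at most the potential of any nested
feasible profile restricted to that coalition. -/
theorem IsStrongEqB.sum_agentCostB_le {p : ∀ j, E j → ℝ} (hp : ∀ j e, 0 ≤ p j e)
    {c : ∀ j, E j → ℕ} {σ τ : Fin n → ∀ j, E j} (hσ : IsStrongEqB p c σ) (hτ : FeasibleB c τ)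
    (h : ∀ j e, (∀ i, σ i j = e → τ i j = e) ∨ (∀ i, τ i j = e → σ i j = e))
    (C : Finset (Fin n)) : ∑ i ∈ C, agentCostB p σ i ≤ coalitionPotential p τ C := by
  induction C using Finset.strongInduction with
  | H C ih =>
    rcases C.eq_empty_or_nonempty with rfl | hC
    · simp [coalitionPotential, harmonicReal]
    obtain ⟨i, hi, hle⟩ : ∃ i ∈ C,
        agentCostB p σ i ≤ agentCostB p (fun i => if i ∈ C then τ i else σ i) i := by
      by_contra! hlt
      exact hσ.2 ⟨C, _, hC, hσ.1.ite_mem hτ h C, fun i hi => if_neg hi, hlt⟩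
    have hcost : agentCostB p (fun i => if i ∈ C then τ i else σ i) i ≤
        ∑ j, p j (τ i j) / ((C.filter fun l => τ l j = τ i j).card : ℝ) := by
      refine Finset.sum_le_sum fun j _ => ?_
      simp only [hi, if_true]
      refine div_le_div_of_nonneg_left (hp _ _) ?_ ?_
      · exact Nat.cast_pos.2 (Finset.card_pos.2 ⟨i, Finset.mem_filter.2 ⟨hi, rfl⟩⟩)
      · refine Nat.cast_le.2 (Finset.card_le_card fun l hl => ?_)
        obtain ⟨hlC, hl⟩ := Finset.mem_filter.1 hl
        simp [hlC, hl]
    rw [coalitionPotential_eq_erase_add p τ hi, ← Finset.sum_erase_add _ _ hi]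
    exact add_le_add (ih _ (Finset.erase_ssubset hi)) (hle.trans hcost)

theorem coalitionPotential_univ_le {p : ∀ j, E j → ℝ} (hp : ∀ j e, 0 ≤ p j e)
    (τ : Fin n → ∀ j, E j) :
    coalitionPotential p τ Finset.univ ≤ harmonicReal n * socialCostB p τ := by
  rw [socialCostB_eq_sum_used, Finset.mul_sum]
  refine Finset.sum_le_sum fun j _ => ?_
  rw [Finset.mul_sum]
  refine Finset.sum_le_sum fun e _ => ?_
  change p j e * harmonicReal (blockLoad τ j e) ≤ _
  split_ifs with h0
  · simp [h0, harmonicReal]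
  · rw [mul_comm]
    refine mul_le_mul_of_nonneg_right (harmonicReal_mono ?_) (hp j e)
    exact (Finset.card_le_univ _).trans_eq (Fintype.card_fin n)

end

/-- In every feasible symmetric capacitated cost-sharing game on a series of `k`
parallel-edge blocks with `n` agents, the social cost of any strong equilibrium is at
most `H_n` times the social cost of any feasible profile. -/
theorem series_of_parallel_blocks_SPoA_le_harmonic
    {n k : ℕ} (hn : 1 ≤ n) (hk : 1 ≤ k)
    {E : Fin k → Type*} [∀ j, Fintype (E j)] [∀ j, DecidableEq (E j)] [∀ j, Nonempty (E j)]
    (p : ∀ j, E j → ℝ) (hp : ∀ j e, 0 ≤ p j e) (c : ∀ j, E j → ℕ)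
    (σ : Fin n → ∀ j, E j) (hσ : IsStrongEqB p c σ)
    (τ : Fin n → ∀ j, E j) (hτ : FeasibleB c τ) :
    socialCostB p σ ≤ harmonicReal n * socialCostB p τ := by
  choose π hπ using fun j => exists_perm_fibers_nested (fun i => σ i j) (fun i => τ i j)
  have hload : ∀ j e, blockLoad (fun i j => τ (π j i) j) j e = blockLoad τ j e := fun j e =>
    Finset.card_equiv (π j) fun i => by simp
  have hfeas : FeasibleB c fun i j => τ (π j i) j := fun j e => (hload j e).trans_le (hτ j e)
  calc socialCostB p σ ≤ coalitionPotential p (fun i j => τ (π j i) j) Finset.univ :=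
        hσ.sum_agentCostB_le hp hfeas hπ Finset.univ
    _ ≤ harmonicReal n * socialCostB p fun i j => τ (π j i) j := coalitionPotential_univ_le hp _
    _ = harmonicReal n * socialCostB p τ := by
        simp only [socialCostB_eq_sum_used, hload]
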